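/- Let s, k, n be integers with 4 ≤ k ≤ 2^{s−1} and 2^s + 2^{s−1} + k ≤ n ≤ 2^{s+1}. Then in A(k,n) ⊗_{ℤ/2} A(k,n) the product z(w_1)^{2^{s+1}−1} · z(w_2)^{2^{s+1}−1} · z(w_3)^{2^s−1} is nonzero; consequently the zero-divisor cup-length zcl(k,n) is at least 5·2^s − 3. -/

import Mathlib

open MvPolynomial TensorProduct

noncomputable section

/-- Weights for the grading: the variable `Sum.inl i` corresponds to the Stiefel-Whitney
class `w_{i+1}` (degree `i+1`), and `Sum.inr j` to the dual class `w̄_{j+1}` (degree `j+1`). -/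
def grassWt (k m : ℕ) : Fin k ⊕ Fin m → ℕ :=
  Sum.elim (fun i => (i : ℕ) + 1) (fun j => (j : ℕ) + 1)

/-- The relation `(1 + w_1 + ⋯ + w_k)·(1 + w̄_1 + ⋯ + w̄_m) - 1`. -/
def grassRel (k m : ℕ) : MvPolynomial (Fin k ⊕ Fin m) (ZMod 2) :=
  (1 + ∑ i : Fin k, X (Sum.inl i)) * (1 + ∑ j : Fin m, X (Sum.inr j)) - 1

/-- The ideal generated by the positive-degree weighted-homogeneous components of the relation. -/
def grassIdeal (k m : ℕ) : Ideal (MvPolynomial (Fin k ⊕ Fin m) (ZMod 2)) :=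
  Ideal.span { p | ∃ d : ℕ, 0 < d ∧
    p = weightedHomogeneousComponent (grassWt k m) d (grassRel k m) }

/-- `GrassCoh k m` is the ring `A(k, n)` with `m = n - k`, i.e. the mod 2 cohomology ring
of the Grassmannian `G_k(ℝ^{k+m})`. -/
abbrev GrassCoh (k m : ℕ) : Type :=
  MvPolynomial (Fin k ⊕ Fin m) (ZMod 2) ⧸ grassIdeal k m

/-- The Stiefel-Whitney class `w_{i+1}` in `A(k, k+m)`. -/
def sw (k m : ℕ) (i : Fin k) : GrassCoh k m :=
  Ideal.Quotient.mk (grassIdeal k m) (X (Sum.inl i))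

/-- `ρ m` : the smallest integral power of `2` that is strictly greater than `m`. -/
def rho (m : ℕ) : ℕ := 2 ^ m.size

/-- The multiplication map `μ : A(k,n) ⊗ A(k,n) → A(k,n)`. -/
def grassMul (k m : ℕ) : GrassCoh k m ⊗[ZMod 2] GrassCoh k m →ₗ[ZMod 2] GrassCoh k m :=
  LinearMap.mul' (ZMod 2) (GrassCoh k m)

/-- The basic zero-divisor `z(x) = x ⊗ 1 + 1 ⊗ x`. -/
def zd (k m : ℕ) (x : GrassCoh k m) : GrassCoh k m ⊗[ZMod 2] GrassCoh k m :=
  x ⊗ₜ 1 + 1 ⊗ₜ x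

/-- The set of lengths of nonzero products of zero-divisors; its greatest element is
the zero-divisor cup-length `zcl(k, k+m)`. -/
def zclSet (k m : ℕ) : Set ℕ :=
  { r : ℕ | ∃ f : Fin r → GrassCoh k m ⊗[ZMod 2] GrassCoh k m,
      (∀ i, f i ∈ LinearMap.ker (grassMul k m)) ∧ ∏ i, f i ≠ 0 }

/-! ### Computing with polynomials over `ZMod 2` in six variables as lists of exponents -/

abbrev GPoly := MvPolynomial (Fin 6) (ZMod 2)

abbrev GExp := ℕ × ℕ × ℕ × ℕ × ℕ × ℕ

def gFun (t : GExp) : Fin 6 →₀ ℕ :=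
  Finsupp.equivFunOnFinite.symm ![t.1, t.2.1, t.2.2.1, t.2.2.2.1, t.2.2.2.2.1, t.2.2.2.2.2]

def gAdd (s t : GExp) : GExp :=
  (s.1 + t.1, s.2.1 + t.2.1, s.2.2.1 + t.2.2.1, s.2.2.2.1 + t.2.2.2.1,
    s.2.2.2.2.1 + t.2.2.2.2.1, s.2.2.2.2.2 + t.2.2.2.2.2)

theorem gFun_add (s t : GExp) : gFun (gAdd s t) = gFun s + gFun t := by
  ext i
  fin_cases i <;> simp [gFun, gAdd]

def gMon (t : GExp) : GPoly := monomial (gFun t) 1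

theorem gMon_add (s t : GExp) : gMon (gAdd s t) = gMon s * gMon t := by
  simp [gMon, gFun_add, monomial_mul]

def gPoly (l : List GExp) : GPoly := (l.map gMon).sum

def gMul (l₁ l₂ : List GExp) : List GExp := l₁.flatMap (fun s => l₂.map (gAdd s))

theorem gPoly_nil : gPoly [] = 0 := by simp [gPoly]

theorem gPoly_cons (t : GExp) (l : List GExp) : gPoly (t :: l) = gMon t + gPoly l := by
  simp [gPoly]

theorem gPoly_append (l₁ l₂ : List GExp) : gPoly (l₁ ++ l₂) = gPoly l₁ + gPoly l₂ := by
  simp [gPoly]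

theorem gPoly_map_add (s : GExp) (l : List GExp) :
    gPoly (l.map (gAdd s)) = gMon s * gPoly l := by
  induction l with
  | nil => simp [gPoly_nil]
  | cons t l ih => simp [gPoly_cons, ih, gMon_add, mul_add]

theorem gPoly_mul (l₁ l₂ : List GExp) : gPoly (gMul l₁ l₂) = gPoly l₁ * gPoly l₂ := by
  induction l₁ with
  | nil => simp [gPoly_nil, gMul]
  | cons t l ih =>
    have : gMul (t :: l) l₂ = l₂.map (gAdd t) ++ gMul l l₂ := by simp [gMul]
    rw [this, gPoly_append, gPoly_map_add, ih, gPoly_cons, add_mul]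

/-- Insert a monomial, cancelling it modulo 2 if it is already there. -/
def gToggle (t : GExp) (l : List GExp) : List GExp :=
  if t ∈ l then l.erase t else t :: l

theorem gAdd_self (p : GPoly) : p + p = 0 := CharTwo.add_self_eq_zero p

theorem gPoly_toggle (t : GExp) (l : List GExp) :
    gPoly (gToggle t l) = gMon t + gPoly l := by
  unfold gToggle
  split_ifs with h
  · have h1 : gPoly l = gMon t + gPoly (l.erase t) := by
      rw [← gPoly_cons]
      exact ((List.perm_cons_erase h).map gMon).sum_eq
    rw [h1, ← add_assoc, gAdd_self, zero_add]
  · rw [gPoly_cons]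

def gNorm (l : List GExp) : List GExp := l.foldr gToggle []

theorem gPoly_norm (l : List GExp) : gPoly (gNorm l) = gPoly l := by
  induction l with
  | nil => rfl
  | cons t l ih =>
    have : gNorm (t :: l) = gToggle t (gNorm l) := rfl
    rw [this, gPoly_toggle, ih, gPoly_cons]

/-- Parity test against the digits `b`. -/
def gTest (b t : GExp) : Bool :=
  t.1 % 2 == b.1 && t.2.1 % 2 == b.2.1 && t.2.2.1 % 2 == b.2.2.1 &&
    t.2.2.2.1 % 2 == b.2.2.2.1 && t.2.2.2.2.1 % 2 == b.2.2.2.2.1 &&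
    t.2.2.2.2.2 % 2 == b.2.2.2.2.2

def gHalf (t : GExp) : GExp :=
  (t.1 / 2, t.2.1 / 2, t.2.2.1 / 2, t.2.2.2.1 / 2, t.2.2.2.2.1 / 2, t.2.2.2.2.2 / 2)

def gStep (b : GExp) (l : List GExp) : List GExp := (l.filter (gTest b)).map gHalf

def gBits (b : GExp) : Prop :=
  b.1 < 2 ∧ b.2.1 < 2 ∧ b.2.2.1 < 2 ∧ b.2.2.2.1 < 2 ∧ b.2.2.2.2.1 < 2 ∧ b.2.2.2.2.2 < 2

instance (b : GExp) : Decidable (gBits b) := by unfold gBits; infer_instance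

def gDbl (b t : GExp) : GExp := gAdd (gAdd t t) b

theorem gTest_iff (b t : GExp) (hb : gBits b) (a : Fin 6 →₀ ℕ) (ν : GExp) :
    2 • a + gFun t = gFun (gDbl b ν) ↔ gTest b t = true ∧ a + gFun (gHalf t) = gFun ν := by
  obtain ⟨t0, t1, t2, t3, t4, t5⟩ := t
  obtain ⟨b0, b1, b2, b3, b4, b5⟩ := b
  obtain ⟨n0, n1, n2, n3, n4, n5⟩ := ν
  simp only [gBits] at hb
  simp only [DFunLike.ext_iff, Fin.forall_fin_succ, gFun, gDbl, gTest, gHalf, gAdd]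
  simp
  omega

theorem gCoeff_mon (b t : GExp) (hb : gBits b) (F : GPoly) (ν : GExp) :
    coeff (gFun (gDbl b ν)) (F ^ 2 * gMon t) =
      if gTest b t then coeff (gFun ν) (F * gMon (gHalf t)) else 0 := by
  rw [← MvPolynomial.expand_zmod]
  induction F using MvPolynomial.induction_on' with
  | monomial a c =>
    rw [MvPolynomial.expand_monomial, gMon, gMon, monomial_mul, monomial_mul, coeff_monomial,
      coeff_monomial]
    have := gTest_iff b t hb a ν
    by_cases h : gTest b t = true <;> simp_all
  | add p q hp hq =>
    rw [map_add, add_mul, coeff_add, hp, hq, add_mul, coeff_add]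
    split_ifs <;> simp

theorem gCoeff_step (b : GExp) (hb : gBits b) (F : GPoly) (ν : GExp) (l : List GExp) :
    coeff (gFun (gDbl b ν)) (F ^ 2 * gPoly l) = coeff (gFun ν) (F * gPoly (gStep b l)) := by
  induction l with
  | nil => simp [gPoly_nil, gStep]
  | cons t l ih =>
    rw [gPoly_cons, mul_add, coeff_add, ih, gCoeff_mon b t hb]
    by_cases h : gTest b t = true
    · have : gStep b (t :: l) = gHalf t :: gStep b l := by simp [gStep, h]
      rw [this, gPoly_cons, mul_add, coeff_add, if_pos h]
    · have : gStep b (t :: l) = gStep b l := by simp [gStep, h]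
      rw [this, if_neg h, zero_add]

/-! ### The three classes and the recursion -/

def gX0 : GExp := (1, 0, 0, 0, 0, 0)
def gX1 : GExp := (0, 1, 0, 0, 0, 0)
def gX2 : GExp := (0, 0, 1, 0, 0, 0)
def gX3 : GExp := (0, 0, 0, 1, 0, 0)
def gX4 : GExp := (0, 0, 0, 0, 1, 0)
def gX5 : GExp := (0, 0, 0, 0, 0, 1)

theorem gMon_eq (t : GExp) : gMon t = X 0 ^ t.1 * X 1 ^ t.2.1 * X 2 ^ t.2.2.1 *
    X 3 ^ t.2.2.2.1 * X 4 ^ t.2.2.2.2.1 * X 5 ^ t.2.2.2.2.2 := by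
  rw [gMon, MvPolynomial.monomial_eq, Finsupp.prod_fintype _ _ (by simp)]
  simp [Fin.prod_univ_succ, gFun, mul_assoc]

def gL1 : List GExp := [gX0, gX1, gX2, gX3, gX4, gX5]
def gL2 : List GExp := [(1,1,0,0,0,0), (1,0,1,0,0,0), (1,0,0,1,0,0), (0,1,1,0,0,0),
  (0,1,0,1,0,0), (0,0,1,1,0,0), (0,0,0,0,1,1)]
def gL3 : List GExp := [(1,1,1,0,0,0), (1,1,0,1,0,0), (1,0,1,1,0,0), (0,1,1,1,0,0)]
def gL12 : List GExp := gMul gL1 gL2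
def gL123 : List GExp := gMul gL12 gL3

def gW : List GExp :=
  gMul [gX1, gX0] (gMul [gX2, gX0] (gMul [gX3, gX0] (gMul [gX2, gX1] (gMul [gX3, gX1]
    (gMul [gX3, gX2] [gX5, gX4])))))

def gQ (i : ℕ) : GPoly :=
  gPoly gL1 ^ (2 ^ (i + 1) - 1) * gPoly gL2 ^ (2 ^ (i + 1) - 1) * gPoly gL3 ^ (2 ^ i - 1)

theorem gQ_zero : gQ 0 = gPoly gL12 := by simp [gQ, gL12, gPoly_mul]

theorem gQ_succ (i : ℕ) : gQ (i + 1) = gQ i ^ 2 * gPoly gL123 := by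
  have h1 : 2 ^ (i + 1 + 1) - 1 = (2 ^ (i + 1) - 1) * 2 + 1 := by
    have := Nat.one_le_two_pow (n := i + 1)
    rw [pow_succ 2 (i + 1)]; omega
  have h2 : 2 ^ (i + 1) - 1 = (2 ^ i - 1) * 2 + 1 := by
    have := Nat.one_le_two_pow (n := i)
    rw [pow_succ 2 i]; omega
  unfold gQ
  rw [h1]
  conv_lhs => rw [h2]
  rw [gL123, gL12, gPoly_mul, gPoly_mul]
  conv_rhs => rw [mul_pow, mul_pow, ← pow_mul, ← pow_mul, ← pow_mul]
  rw [pow_succ, pow_succ, pow_succ (gPoly gL3)]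
  conv_lhs => rw [← h2]
  ring

theorem gCoeff_rec (b : GExp) (hb : gBits b) (i : ℕ) (ν : GExp) (l : List GExp) :
    coeff (gFun (gDbl b ν)) (gQ (i + 1) * gPoly l) =
      coeff (gFun ν) (gQ i * gPoly (gNorm (gStep b (gMul gL123 l)))) := by
  rw [gQ_succ, mul_assoc, ← gPoly_mul, gCoeff_step b hb, gPoly_norm]

def gS1 : List GExp := [(0, 1, 1, 2, 1, 0), (0, 1, 2, 2, 0, 0), (0, 2, 1, 1, 1, 0),
  (0, 2, 2, 1, 0, 0), (1, 0, 2, 1, 1, 0), (1, 0, 3, 1, 0, 0), (1, 1, 0, 2, 1, 0),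
  (1, 1, 2, 0, 1, 0), (1, 1, 3, 0, 0, 0), (1, 2, 0, 1, 1, 0), (2, 0, 1, 1, 1, 0),
  (2, 1, 0, 2, 0, 0), (2, 1, 1, 0, 1, 0), (2, 2, 0, 1, 0, 0), (3, 0, 1, 1, 0, 0),
  (3, 1, 1, 0, 0, 0)]
def gS2 : List GExp := [(0, 1, 1, 0, 1, 0), (0, 1, 2, 0, 0, 0), (1, 1, 0, 0, 1, 0), (2, 1, 0, 0, 0, 0)]
def gS3 : List GExp := [(0, 1, 1, 0, 1, 0), (0, 1, 1, 1, 0, 0), (0, 1, 2, 0, 0, 0)]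
def gS4 : List GExp := [(0, 1, 1, 0, 1, 0), (0, 1, 2, 0, 0, 0)]

theorem gPoly_perm {l₁ l₂ : List GExp} (h : l₁.Perm l₂) : gPoly l₁ = gPoly l₂ :=
  (h.map gMon).sum_eq

theorem gPoly_congr {l₁ l₂ : List GExp} (h : gNorm (l₁ ++ l₂) = []) : gPoly l₁ = gPoly l₂ := by
  have h1 := gPoly_norm (l₁ ++ l₂)
  rw [h, gPoly_nil, gPoly_append] at h1
  exact CharTwo.add_eq_zero.mp h1.symm

def gWn : List GExp := gNorm gW

theorem gPoly_W : gPoly gW = gPoly gWn := (gPoly_norm gW).symm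

/-- Multiply and extract digits at the same time. -/
def gMulStep (b : GExp) (l₁ l₂ : List GExp) : List GExp :=
  l₁.flatMap (fun s => gStep b (l₂.map (gAdd s)))

theorem gMulStep_eq (b : GExp) (l₁ l₂ : List GExp) :
    gStep b (gMul l₁ l₂) = gMulStep b l₁ l₂ := by
  simp [gStep, gMul, gMulStep, List.filter_flatMap, List.map_flatMap]

theorem gStep_one : gPoly (gNorm (gStep (0,1,0,1,0,1) (gMul gL123 gWn))) = gPoly gS1 := by
  rw [gMulStep_eq]
  exact gPoly_congr (by decide +kernel)

theorem gStep_two : gPoly (gNorm (gStep (1,0,1,1,1,1) (gMul gL123 gS1))) = gPoly gS2 := by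
  rw [gMulStep_eq]
  exact gPoly_congr (by decide +kernel)

theorem gStep_three : gPoly (gNorm (gStep (1,0,0,0,1,1) (gMul gL123 gS2))) = gPoly gS3 :=
  gPoly_congr (by decide +kernel)

theorem gStep_four : gPoly (gNorm (gStep (1,0,0,0,1,1) (gMul gL123 gS3))) = gPoly gS4 :=
  gPoly_congr (by decide +kernel)

theorem gStep_five : gPoly (gNorm (gStep (1,0,0,0,1,1) (gMul gL123 gS4))) = gPoly gS4 :=
  gPoly_congr (by decide +kernel)

theorem gFinal_aux (l : List GExp)
    (h : gNorm (gStep (1,1,1,1,1,1) (gMul gL12 (gNorm (gStep (0,1,1,1,0,0) (gMul gL123 l)))))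
      = [(0,0,0,0,0,0)]) :
    coeff (gFun (2,3,3,3,2,2)) (gQ 1 * gPoly l) = 1 := by
  have e1 : ((2,3,3,3,2,2) : GExp) = gDbl (0,1,1,1,0,0) (1,1,1,1,1,1) := by decide
  have e2 : ((1,1,1,1,1,1) : GExp) = gDbl (1,1,1,1,1,1) (0,0,0,0,0,0) := by decide
  rw [e1, gCoeff_rec _ (by decide) 0, gQ_zero, ← gPoly_mul, e2]
  have h3 := gCoeff_step (1,1,1,1,1,1) (by decide) 1 (0,0,0,0,0,0)
    (gMul gL12 (gNorm (gStep (0,1,1,1,0,0) (gMul gL123 l))))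
  rw [one_pow, one_mul, ← gPoly_norm (gStep _ _), h, one_mul] at h3
  rw [h3]
  simp [gPoly, gMon]

theorem gFinal_two : coeff (gFun (2,3,3,3,2,2)) (gQ 1 * gPoly gS2) = 1 :=
  gFinal_aux _ (by decide +kernel)

theorem gFinal_three : coeff (gFun (2,3,3,3,2,2)) (gQ 1 * gPoly gS3) = 1 :=
  gFinal_aux _ (by decide +kernel)

theorem gFinal_four : coeff (gFun (2,3,3,3,2,2)) (gQ 1 * gPoly gS4) = 1 :=
  gFinal_aux _ (by decide +kernel)

/-- The target exponents along the recursion. -/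
def gT (r : ℕ) : GExp := (3 * r - 1, 3 * r, 3 * r, 3 * r, 3 * r - 1, 3 * r - 1)

theorem gT_double (r : ℕ) (hr : 1 ≤ r) : gT (2 * r) = gDbl (1,0,0,0,1,1) (gT r) := by
  simp only [gT, gDbl, gAdd, Prod.mk.injEq]
  omega

theorem gRec (u : ℕ) (l : List GExp) :
    coeff (gFun (gT (2 ^ (u + 1)))) (gQ (u + 2) * gPoly l) =
      coeff (gFun (gT (2 ^ u))) (gQ (u + 1) *
        gPoly (gNorm (gStep (1,0,0,0,1,1) (gMul gL123 l)))) := by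
  rw [pow_succ, mul_comm (2 ^ u) 2, gT_double _ Nat.one_le_two_pow, gCoeff_rec _ (by decide)]

theorem gStable (u : ℕ) : coeff (gFun (gT (2 ^ u))) (gQ (u + 1) * gPoly gS4) = 1 := by
  induction u with
  | zero => exact gFinal_four
  | succ u ih => rw [gRec, gStep_five, ih]

theorem gS2_coeff (u : ℕ) : coeff (gFun (gT (2 ^ u))) (gQ (u + 1) * gPoly gS2) = 1 := by
  match u with
  | 0 => exact gFinal_two
  | 1 => rw [gRec, gStep_three]; exact gFinal_three
  | u + 2 => rw [gRec, gStep_three, gRec, gStep_four, gStable]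

/-- The target exponents. -/
def gMu (q : ℕ) : GExp := (3 * q - 2, 3 * q + 1, 3 * q + 2, 3 * q + 3, 3 * q - 2, 3 * q - 1)

theorem gMain (u : ℕ) : coeff (gFun (gMu (2 ^ (u + 2)))) (gQ (u + 3) * gPoly gW) = 1 := by
  have hr := Nat.one_le_two_pow (n := u)
  have e : gMu (2 ^ (u + 2)) = gDbl (0,1,0,1,0,1) (gDbl (1,0,1,1,1,1) (gT (2 ^ u))) := by
    rw [pow_add]
    generalize 2 ^ u = r at hr
    simp only [gMu, gT, gDbl, gAdd, Prod.mk.injEq]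
    omega
  rw [e, gPoly_W, gCoeff_rec _ (by decide), gStep_one, gCoeff_rec _ (by decide), gStep_two, gS2_coeff]

/-! ### Homomorphisms out of the cohomology ring -/

theorem gComp_coeff {σ B : Type*} [CommRing B] [Algebra (ZMod 2) B] (wt : σ → ℕ) (b : σ → B)
    (d : ℕ) (p : MvPolynomial σ (ZMod 2)) :
    (aeval (fun v => Polynomial.C (b v) * Polynomial.X ^ wt v) p : Polynomial B).coeff d =
      aeval b (weightedHomogeneousComponent wt d p) := by
  induction p using MvPolynomial.induction_on' with
  | monomial a c =>
    rw [weightedHomogeneousComponent_of_mem (n := Finsupp.weight wt a)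
      (by exact isWeightedHomogeneous_monomial wt a c rfl), aeval_monomial]
    have h : (a.prod fun i k => (Polynomial.C (b i) * Polynomial.X ^ wt i) ^ k : Polynomial B) =
        Polynomial.C (a.prod fun i k => b i ^ k) * Polynomial.X ^ (Finsupp.weight wt a) := by
      simp only [Finsupp.prod, mul_pow, Finset.prod_mul_distrib, map_prod, map_pow,
        Finsupp.weight_apply, Finsupp.sum, ← pow_mul, Finset.prod_pow_eq_pow_sum, smul_eq_mul,
        mul_comm]
    rw [h, ← mul_assoc, Polynomial.algebraMap_apply, ← Polynomial.C_mul,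
      Polynomial.coeff_C_mul_X_pow]
    split_ifs
    · rw [aeval_monomial]
    · simp
  | add p q hp hq => simp only [map_add, Polynomial.coeff_add, hp, hq]

theorem gPolynomial_expand {B : Type*} [CommRing B] (E : Polynomial B) (k : ℕ)
    (h0 : E.coeff 0 = 1) (hk : E.natDegree ≤ k) :
    1 + ∑ i : Fin k, Polynomial.C (E.coeff (i + 1)) * Polynomial.X ^ ((i : ℕ) + 1) = E := by
  conv_rhs => rw [E.as_sum_range_C_mul_X_pow' (n := k + 1) (by omega)]
  rw [Finset.sum_range_succ', h0, Finset.sum_range]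
  simp [add_comm]

theorem grass_hom {B : Type*} [CommRing B] [Algebra (ZMod 2) B] (k m : ℕ) (E H : Polynomial B)
    (hE0 : E.coeff 0 = 1) (hH0 : H.coeff 0 = 1) (hE : E.natDegree ≤ k) (hH : H.natDegree ≤ m)
    (hEH : E * H = 1) :
    ∃ φ : GrassCoh k m →ₐ[ZMod 2] B, ∀ i : Fin k, φ (sw k m i) = E.coeff (i + 1) := by
  set b : Fin k ⊕ Fin m → B := Sum.elim (fun i => E.coeff (i + 1)) (fun j => H.coeff (j + 1))
    with hb
  have hrel : (aeval (fun v => Polynomial.C (b v) * Polynomial.X ^ grassWt k m v)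
      (grassRel k m) : Polynomial B) = 0 := by
    simp only [grassRel, map_sub, map_mul, map_add, map_one, map_sum, aeval_X]
    simp only [hb, grassWt, Sum.elim_inl, Sum.elim_inr]
    rw [gPolynomial_expand E k hE0 hE, gPolynomial_expand H m hH0 hH, hEH, sub_self]
  have hker : ∀ a ∈ grassIdeal k m, (aeval b : MvPolynomial (Fin k ⊕ Fin m) (ZMod 2) →ₐ[ZMod 2] B) a = 0 := by
    intro a ha
    have : grassIdeal k m ≤ RingHom.ker
        (aeval b : MvPolynomial (Fin k ⊕ Fin m) (ZMod 2) →ₐ[ZMod 2] B) := by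
      refine Ideal.span_le.mpr ?_
      rintro p ⟨d, -, rfl⟩
      show aeval b _ = 0
      rw [← gComp_coeff, hrel, Polynomial.coeff_zero]
    exact this ha
  refine ⟨Ideal.Quotient.liftₐ (grassIdeal k m) (aeval b) hker, fun i => ?_⟩
  show aeval b (X (Sum.inl i)) = _
  simp [hb]

theorem grass_hom_quot {R : Type} [CommRing R] [Algebra (ZMod 2) R] (J : Ideal R) (k m : ℕ)
    (E : Polynomial R) (G : PowerSeries R) (hE0 : E.coeff 0 = 1) (hE : E.natDegree ≤ k)
    (hEG : (E : PowerSeries R) * G = 1) (hG : ∀ j, m < j → PowerSeries.coeff j G ∈ J) :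
    ∃ φ : GrassCoh k m →ₐ[ZMod 2] (R ⧸ J),
      ∀ i : Fin k, φ (sw k m i) = Ideal.Quotient.mk J (E.coeff (i + 1)) := by
  set f := Ideal.Quotient.mk J with hf
  have hG0 : PowerSeries.coeff 0 G = 1 := by
    have := congrArg (PowerSeries.coeff 0) hEG
    simpa [PowerSeries.coeff_mul, hE0] using this
  have hH : ((PowerSeries.trunc (m + 1) (PowerSeries.map f G) : Polynomial (R ⧸ J)) :
      PowerSeries (R ⧸ J)) = PowerSeries.map f G := by
    ext j
    rw [Polynomial.coeff_coe, PowerSeries.coeff_trunc, PowerSeries.coeff_map]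
    split_ifs with h
    · rfl
    · exact (Ideal.Quotient.eq_zero_iff_mem.mpr (hG j (by omega))).symm
  obtain ⟨φ, hφ⟩ := grass_hom k m (E.map f) (PowerSeries.trunc (m + 1) (PowerSeries.map f G))
    (by simp [hE0]) (by simp [PowerSeries.coeff_trunc, PowerSeries.coeff_map, -PowerSeries.coeff_zero_eq_constantCoeff, hG0])
    (Polynomial.natDegree_map_le.trans hE)
    (Nat.lt_succ_iff.mp (PowerSeries.natDegree_trunc_lt _ m))
    (by
      rw [← Polynomial.coe_inj, Polynomial.coe_mul, hH, Polynomial.polynomial_map_coe, ← map_mul,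
        hEG, map_one, Polynomial.coe_one])
  exact ⟨φ, fun i => by rw [hφ, Polynomial.coeff_map]⟩

/-! ### Geometric series -/

section geom
variable {R : Type*} [CommRing R]

/-- `1 / (1 + x T)`. -/
def gGeom (x : R) : PowerSeries R := PowerSeries.mk (fun j => (-x) ^ j)

theorem gGeom_mul (x : R) : (1 + PowerSeries.C x * PowerSeries.X) * gGeom x = 1 := by
  ext j
  rw [add_mul, one_mul, mul_assoc, map_add, PowerSeries.coeff_C_mul]
  cases j with
  | zero => simp [gGeom]
  | succ j =>
    rw [PowerSeries.coeff_succ_X_mul, PowerSeries.coeff_one]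
    simp [gGeom, pow_succ]
    ring

theorem gGeom_two (a b : R) :
    PowerSeries.C (b - a) * (gGeom a * gGeom b) =
      PowerSeries.C b * gGeom b - PowerSeries.C a * gGeom a := by
  have ha := gGeom_mul a
  have hb := gGeom_mul b
  simp only [map_sub]
  linear_combination (PowerSeries.C b * gGeom b) * ha - (PowerSeries.C a * gGeom a) * hb

/-- Vandermonde product. -/
def gV (a b c d : R) : R := (b - a) * (c - a) * (d - a) * (c - b) * (d - b) * (d - c)

theorem gGeom_four (a b c d : R) :
    PowerSeries.C (gV a b c d) * (gGeom a * gGeom b * gGeom c * gGeom d) =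
      PowerSeries.C (-(a ^ 3 * ((c - b) * (d - b) * (d - c)))) * gGeom a
      + PowerSeries.C (b ^ 3 * ((c - a) * (d - a) * (d - c))) * gGeom b
      + PowerSeries.C (-(c ^ 3 * ((b - a) * (d - a) * (d - b)))) * gGeom c
      + PowerSeries.C (d ^ 3 * ((b - a) * (c - a) * (c - b))) * gGeom d := by
  have ha := gGeom_mul a
  have hb := gGeom_mul b
  have hc := gGeom_mul c
  have hd := gGeom_mul d
  simp only [gV, map_sub, map_mul, map_neg, map_pow]
  generalize PowerSeries.C a = A at *
  generalize PowerSeries.C b = B at *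
  generalize PowerSeries.C c = Cc at *
  generalize PowerSeries.C d = D at *
  generalize (PowerSeries.X : PowerSeries R) = T at *
  generalize gGeom a = x at *
  generalize gGeom b = y at *
  generalize gGeom c = z at *
  generalize gGeom d = w at *
  have key : (B - A) * (Cc - A) * (D - A) * (Cc - B) * (D - B) * (D - Cc) =
      -(A ^ 3 * ((Cc - B) * (D - B) * (D - Cc))) * ((1 + B * T) * (1 + Cc * T) * (1 + D * T))
      + (B ^ 3 * ((Cc - A) * (D - A) * (D - Cc))) * ((1 + A * T) * (1 + Cc * T) * (1 + D * T))
      + -(Cc ^ 3 * ((B - A) * (D - A) * (D - B))) * ((1 + A * T) * (1 + B * T) * (1 + D * T))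
      + (D ^ 3 * ((B - A) * (Cc - A) * (Cc - B))) * ((1 + A * T) * (1 + B * T) * (1 + Cc * T)) := by
    ring
  rw [key]
  have e1 : ∀ P : PowerSeries R, P * ((1 + B * T) * (1 + Cc * T) * (1 + D * T)) * (x * y * z * w)
      = P * x := fun P => by
    calc _ = P * x * (((1 + B * T) * y) * ((1 + Cc * T) * z) * ((1 + D * T) * w)) := by ring
      _ = _ := by rw [hb, hc, hd]; ring
  have e2 : ∀ P : PowerSeries R, P * ((1 + A * T) * (1 + Cc * T) * (1 + D * T)) * (x * y * z * w)
      = P * y := fun P => by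
    calc _ = P * y * (((1 + A * T) * x) * ((1 + Cc * T) * z) * ((1 + D * T) * w)) := by ring
      _ = _ := by rw [ha, hc, hd]; ring
  have e3 : ∀ P : PowerSeries R, P * ((1 + A * T) * (1 + B * T) * (1 + D * T)) * (x * y * z * w)
      = P * z := fun P => by
    calc _ = P * z * (((1 + A * T) * x) * ((1 + B * T) * y) * ((1 + D * T) * w)) := by ring
      _ = _ := by rw [ha, hb, hd]; ring
  have e4 : ∀ P : PowerSeries R, P * ((1 + A * T) * (1 + B * T) * (1 + Cc * T)) * (x * y * z * w)
      = P * w := fun P => by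
    calc _ = P * w * (((1 + A * T) * x) * ((1 + B * T) * y) * ((1 + Cc * T) * z)) := by ring
      _ = _ := by rw [ha, hb, hc]; ring
  rw [add_mul, add_mul, add_mul, e1, e2, e3, e4]

end geom

/-! ### The ideal and the final argument -/

/-- The largest ideal on which `p ↦ coeff μ (p * W)` vanishes. -/
def gIdeal (μ : Fin 6 →₀ ℕ) (W : GPoly) : Ideal GPoly where
  carrier := {p | ∀ g, coeff μ (p * g * W) = 0}
  zero_mem' := by intro g; simp
  add_mem' := by
    intro a b ha hb g
    rw [add_mul, add_mul, coeff_add, ha g, hb g, add_zero]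
  smul_mem' := by
    intro c p hp g
    have := hp (c * g)
    rw [smul_eq_mul]
    rwa [show c * p * g * W = p * (c * g) * W by ring]

theorem gCoeff_zero (μ : Fin 6 →₀ ℕ) (i : Fin 6) (e : ℕ) (h : μ i < e) (p : GPoly) :
    coeff μ (X i ^ e * p) = 0 := by
  rw [X_pow_eq_monomial, coeff_monomial_mul', if_neg]
  intro hle
  have := hle i
  simp at this
  omega

theorem gCoeff_zero_of_eq (μ : Fin 6 →₀ ℕ) (i : Fin 6) (r j : ℕ) (h : μ i < r + j) (c p : GPoly) :
    coeff μ (X i ^ r * c * (-X i) ^ j * p) = 0 := by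
  have : X i ^ r * c * (-X i) ^ j * p = X i ^ (r + j) * (c * p * (-1) ^ j) := by
    rw [neg_pow]; ring
  rw [this, gCoeff_zero μ i _ h]

theorem gMem_four (μ : Fin 6 →₀ ℕ) (U : GPoly) (j : ℕ) (h0 : μ 0 < 3 + j) (h1 : μ 1 < 3 + j)
    (h2 : μ 2 < 3 + j) (h3 : μ 3 < 3 + j) :
    PowerSeries.coeff j (gGeom (X 0 : GPoly) * gGeom (X 1) * gGeom (X 2) * gGeom (X 3)) ∈
      gIdeal μ (gV (X 0) (X 1) (X 2) (X 3) * U) := by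
  intro g
  have h := congrArg (PowerSeries.coeff j) (gGeom_four (X 0 : GPoly) (X 1) (X 2) (X 3))
  simp only [PowerSeries.coeff_C_mul, map_add] at h
  generalize PowerSeries.coeff j (gGeom (X 0 : GPoly) * gGeom (X 1) * gGeom (X 2) * gGeom (X 3))
    = H at *
  rw [show H * g * (gV (X 0) (X 1) (X 2) (X 3) * U) =
    (gV (X 0) (X 1) (X 2) (X 3) * H) * (g * U) by ring, h]
  simp only [gGeom, PowerSeries.coeff_mk, add_mul, coeff_add, neg_mul, coeff_neg]
  rw [gCoeff_zero_of_eq μ 0 3 j h0, gCoeff_zero_of_eq μ 1 3 j h1, gCoeff_zero_of_eq μ 2 3 j h2,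
    gCoeff_zero_of_eq μ 3 3 j h3]
  simp

theorem gMem_two (μ : Fin 6 →₀ ℕ) (U : GPoly) (j : ℕ) (h4 : μ 4 < 1 + j) (h5 : μ 5 < 1 + j) :
    PowerSeries.coeff j (gGeom (X 4 : GPoly) * gGeom (X 5)) ∈
      gIdeal μ (U * (X 5 - X 4)) := by
  intro g
  have h := congrArg (PowerSeries.coeff j) (gGeom_two (X 4 : GPoly) (X 5))
  simp only [PowerSeries.coeff_C_mul, map_sub] at h
  rw [← map_sub, PowerSeries.coeff_C_mul] at h
  generalize PowerSeries.coeff j (gGeom (X 4 : GPoly) * gGeom (X 5)) = H at *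
  rw [show H * g * (U * (X 5 - X 4)) = ((X 5 - X 4) * H) * (g * U) by ring, h]
  simp only [gGeom, PowerSeries.coeff_mk, sub_mul, coeff_sub]
  have a4 := gCoeff_zero_of_eq μ 4 1 j h4 1 (g * U)
  have a5 := gCoeff_zero_of_eq μ 5 1 j h5 1 (g * U)
  rw [pow_one, mul_one] at a4 a5
  rw [a4, a5, sub_zero]

theorem gPoly_gW : gPoly gW = gV (X 0) (X 1) (X 2) (X 3) * (X 5 - X 4) := by
  simp only [gW, gPoly_mul, gPoly_cons, gPoly_nil, gMon_eq, gX0, gX1, gX2, gX3, gX4, gX5, gV,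
    CharTwo.sub_eq_add]
  ring

theorem gPoly_gL1 : gPoly gL1 = (X 0 + X 1 + X 2 + X 3) + (X 4 + X 5) := by
  simp only [gL1, gPoly_cons, gPoly_nil, gMon_eq, gX0, gX1, gX2, gX3, gX4, gX5]
  ring

theorem gPoly_gL2 : gPoly gL2 = (X 0 * X 1 + X 0 * X 2 + X 0 * X 3 + X 1 * X 2 + X 1 * X 3
    + X 2 * X 3) + X 4 * X 5 := by
  simp only [gL2, gPoly_cons, gPoly_nil, gMon_eq]
  ring

theorem gPoly_gL3 : gPoly gL3 = X 0 * X 1 * X 2 + X 0 * X 1 * X 3 + X 0 * X 2 * X 3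
    + X 1 * X 2 * X 3 := by
  simp only [gL3, gPoly_cons, gPoly_nil, gMon_eq]
  ring

section elem
variable {R : Type*} [CommRing R]

def gE2 (a b : R) : Polynomial R :=
  (1 + Polynomial.C a * Polynomial.X) * (1 + Polynomial.C b * Polynomial.X)

def gE4 (a b c d : R) : Polynomial R := gE2 a b * gE2 c d

theorem gE2_eq (a b : R) : gE2 a b = 1 + Polynomial.C (a + b) * Polynomial.X
    + Polynomial.C (a * b) * Polynomial.X ^ 2 := by
  simp only [gE2, map_add, map_mul]; ring

theorem gE4_eq (a b c d : R) : gE4 a b c d = 1 + Polynomial.C (a + b + c + d) * Polynomial.X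
    + Polynomial.C (a * b + a * c + a * d + b * c + b * d + c * d) * Polynomial.X ^ 2
    + Polynomial.C (a * b * c + a * b * d + a * c * d + b * c * d) * Polynomial.X ^ 3
    + Polynomial.C (a * b * c * d) * Polynomial.X ^ 4 := by
  simp only [gE4, gE2, map_add, map_mul]; ring

theorem gE2_deg (a b : R) : (gE2 a b).natDegree ≤ 2 := by
  rw [gE2_eq]; compute_degree

theorem gE4_deg (a b c d : R) : (gE4 a b c d).natDegree ≤ 4 := by
  rw [gE4_eq]; compute_degree

theorem gE2_mul (a b : R) : (gE2 a b : PowerSeries R) * (gGeom a * gGeom b) = 1 := by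
  have ha := gGeom_mul a
  have hb := gGeom_mul b
  simp only [gE2, Polynomial.coe_mul, Polynomial.coe_add, Polynomial.coe_one, Polynomial.coe_C,
    Polynomial.coe_X]
  rw [mul_mul_mul_comm, ha, hb, one_mul]

theorem gE4_mul (a b c d : R) :
    (gE4 a b c d : PowerSeries R) * (gGeom a * gGeom b * gGeom c * gGeom d) = 1 := by
  rw [gE4, Polynomial.coe_mul, mul_assoc (gGeom a * gGeom b), mul_mul_mul_comm, gE2_mul, gE2_mul,
    one_mul]

end elem

theorem g_nonzero (u k m : ℕ) (hk4 : 4 ≤ k) (hk0 : 0 < k) (hk1 : 1 < k) (hk2 : 2 < k)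
    (hm : 3 * 2 ^ (u + 2) ≤ m) :
    zd k m (sw k m ⟨0, hk0⟩) ^ (2 ^ (u + 4) - 1) *
      zd k m (sw k m ⟨1, hk1⟩) ^ (2 ^ (u + 4) - 1) *
      zd k m (sw k m ⟨2, hk2⟩) ^ (2 ^ (u + 3) - 1) ≠ 0 := by
  have hμ : ∀ i : Fin 6, gFun (gMu (2 ^ (u + 2))) i ≤ 3 * 2 ^ (u + 2) + 3 ∧
      (4 ≤ i → gFun (gMu (2 ^ (u + 2))) i ≤ 3 * 2 ^ (u + 2)) := by
    intro i
    fin_cases i <;> simp [gFun, gMu] <;> omega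
  have hmain := gMain u
  rw [gPoly_gW] at hmain
  generalize gFun (gMu (2 ^ (u + 2))) = μ at *
  set J := gIdeal μ (gV (X 0) (X 1) (X 2) (X 3) * (X 5 - X 4)) with hJ
  obtain ⟨φ, hφ⟩ := grass_hom_quot J k m (gE4 (X 0) (X 1) (X 2) (X 3)) _
    (by rw [gE4_eq]; simp) ((gE4_deg _ _ _ _).trans hk4) (gE4_mul _ _ _ _)
    (fun j hj => gMem_four μ _ j (by have := (hμ 0).1; omega) (by have := (hμ 1).1; omega)
      (by have := (hμ 2).1; omega) (by have := (hμ 3).1; omega))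
  obtain ⟨ψ, hψ⟩ := grass_hom_quot J k m (gE2 (X 4) (X 5)) _
    (by rw [gE2_eq]; simp) ((gE2_deg _ _).trans (by omega)) (gE2_mul _ _)
    (fun j hj => gMem_two μ _ j (by have := (hμ 4).2 (by decide); omega)
      (by have := (hμ 5).2 (by decide); omega))
  intro h
  have hz : ∀ i : Fin k, Algebra.TensorProduct.productMap φ ψ (zd k m (sw k m i)) =
      Ideal.Quotient.mk J ((gE4 (X 0) (X 1) (X 2) (X 3)).coeff (i + 1) +
        (gE2 (X 4) (X 5)).coeff (i + 1)) := by
    intro i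
    rw [zd, map_add, Algebra.TensorProduct.productMap_left_apply,
      Algebra.TensorProduct.productMap_right_apply, hφ, hψ, map_add]
  have h2 := congrArg (Algebra.TensorProduct.productMap φ ψ) h
  rw [map_mul, map_mul, map_pow, map_pow, map_pow, hz, hz, hz, map_zero, ← map_pow, ← map_pow,
    ← map_pow, ← map_mul, ← map_mul, Ideal.Quotient.eq_zero_iff_mem] at h2
  have h3 := h2 1
  have c1 : (gE4 (X 0) (X 1) (X 2) (X 3) : Polynomial GPoly).coeff (0 + 1) +
      (gE2 (X 4) (X 5)).coeff (0 + 1) = gPoly gL1 := by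
    rw [gPoly_gL1, gE4_eq, gE2_eq]
    simp [Polynomial.coeff_one, Polynomial.coeff_X, Polynomial.coeff_X_pow, Polynomial.coeff_C, -map_add, -map_mul]
  have c2 : (gE4 (X 0) (X 1) (X 2) (X 3) : Polynomial GPoly).coeff (1 + 1) +
      (gE2 (X 4) (X 5)).coeff (1 + 1) = gPoly gL2 := by
    rw [gPoly_gL2, gE4_eq, gE2_eq]
    simp [Polynomial.coeff_one, Polynomial.coeff_X, Polynomial.coeff_X_pow, Polynomial.coeff_C, -map_add, -map_mul]
  have c3 : (gE4 (X 0) (X 1) (X 2) (X 3) : Polynomial GPoly).coeff (2 + 1) +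
      (gE2 (X 4) (X 5)).coeff (2 + 1) = gPoly gL3 := by
    rw [gPoly_gL3, gE4_eq, gE2_eq]
    simp [Polynomial.coeff_one, Polynomial.coeff_X, Polynomial.coeff_X_pow, Polynomial.coeff_C, -map_add, -map_mul]
  simp only [c1, c2, c3, mul_one] at h3
  unfold gQ at hmain
  rw [h3] at hmain
  exact zero_ne_one hmain

/-! ### Zero-divisor products -/

/-- `x` is a product of `r` zero-divisors. -/
def gIsProd (k m r : ℕ) (x : GrassCoh k m ⊗[ZMod 2] GrassCoh k m) : Prop :=
  ∃ f : Fin r → GrassCoh k m ⊗[ZMod 2] GrassCoh k m,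
    (∀ i, f i ∈ LinearMap.ker (grassMul k m)) ∧ ∏ i, f i = x

theorem zd_mem (k m : ℕ) (x : GrassCoh k m) : zd k m x ∈ LinearMap.ker (grassMul k m) := by
  rw [LinearMap.mem_ker, grassMul, zd, map_add, LinearMap.mul'_apply, LinearMap.mul'_apply,
    mul_one, one_mul, ← two_smul (ZMod 2) x, show (2 : ZMod 2) = 0 from rfl, zero_smul]

theorem gIsProd_pow (k m r : ℕ) (x : GrassCoh k m) : gIsProd k m r (zd k m x ^ r) :=
  ⟨fun _ => zd k m x, fun _ => zd_mem k m x, by simp⟩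

theorem gIsProd_mul {k m r t : ℕ} {x y : GrassCoh k m ⊗[ZMod 2] GrassCoh k m}
    (hx : gIsProd k m r x) (hy : gIsProd k m t y) : gIsProd k m (r + t) (x * y) := by
  obtain ⟨f, hf, rfl⟩ := hx
  obtain ⟨g, hg, rfl⟩ := hy
  refine ⟨Fin.append f g, fun i => ?_, ?_⟩
  · refine Fin.addCases (fun i => ?_) (fun i => ?_) i
    · rw [Fin.append_left]; exact hf i
    · rw [Fin.append_right]; exact hg i
  · rw [Fin.prod_univ_add]; simp

/-- For `4 ≤ k ≤ 2^{s-1}` and `2^s + 2^{s-1} + k ≤ n ≤ 2^{s+1}`: in `A(k,n) ⊗ A(k,n)`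
the product `z(w_1)^{2^{s+1}-1} · z(w_2)^{2^{s+1}-1} · z(w_3)^{2^s-1}` is nonzero;
hence `zcl(k,n) ≥ 5·2^s - 3`. -/
theorem gkn_zcl_lb2 (s k n : ℕ) (hk4 : 4 ≤ k) (hk : k ≤ 2 ^ (s - 1))
    (hn1 : 2 ^ s + 2 ^ (s - 1) + k ≤ n) (hn2 : n ≤ 2 ^ (s + 1)) :
    zd k (n - k) (sw k (n - k) ⟨0, by omega⟩) ^ (2 ^ (s + 1) - 1) *
      zd k (n - k) (sw k (n - k) ⟨1, by omega⟩) ^ (2 ^ (s + 1) - 1) *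
      zd k (n - k) (sw k (n - k) ⟨2, by omega⟩) ^ (2 ^ s - 1) ≠ 0 ∧
    5 * 2 ^ s - 3 ∈ zclSet k (n - k) := by
  have hs : 3 ≤ s := by
    by_contra hlt
    have : 2 ^ (s - 1) ≤ 2 ^ 1 := Nat.pow_le_pow_right (by norm_num) (by omega)
    omega
  obtain ⟨u, rfl⟩ : ∃ u, s = u + 3 := ⟨s - 3, by omega⟩
  have h1 : 2 ^ (u + 3) = 2 * 2 ^ (u + 2) := by ring
  have hm : 3 * 2 ^ (u + 2) ≤ n - k := by
    rw [show u + 3 - 1 = u + 2 by omega] at hn1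
    omega
  have hne := g_nonzero u k (n - k) hk4 (by omega) (by omega) (by omega) hm
  refine ⟨hne, ?_⟩
  have hp := gIsProd_mul (gIsProd_mul
    (gIsProd_pow k (n - k) (2 ^ (u + 4) - 1) (sw k (n - k) ⟨0, by omega⟩))
    (gIsProd_pow k (n - k) (2 ^ (u + 4) - 1) (sw k (n - k) ⟨1, by omega⟩)))
    (gIsProd_pow k (n - k) (2 ^ (u + 3) - 1) (sw k (n - k) ⟨2, by omega⟩))
  have hr : 2 ^ (u + 4) - 1 + (2 ^ (u + 4) - 1) + (2 ^ (u + 3) - 1) = 5 * 2 ^ (u + 3) - 3 := by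
    have h2 : 2 ^ (u + 4) = 2 * 2 ^ (u + 3) := by ring
    have h3 := Nat.one_le_two_pow (n := u + 3)
    omega
  rw [hr] at hp
  obtain ⟨f, hf, hfx⟩ := hp
  exact ⟨f, hf, by rw [hfx]; exact hne⟩
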